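/- Let s ≥ t > r ≥ 2 be fixed integers. For n ∈ ℕ, p ∈ (0,1], and a t-element subset W of [n], define Σ(n,p,W) = Σ over all collections 𝓔 of s-element subsets of [n] such that 𝓔 is a minimal non-trivial r-cover of W, of p^{|𝓔|}. If p = p(n) ∈ (0,1] satisfies p(n)·n^{s−r+1/m_r(K^{(r)}_t)} → 0 as n → ∞, then max over t-subsets W of [n] of Σ(n,p(n),W)/(p(n)·n^{s−t}) → 0 as n → ∞. (Equivalently, the expected number of minimal non-trivial r-covers of W consisting of edges of H(n,s,p) is o(p·n^{s−t}).) -/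

import Mathlib

open Finset

/-- An `r`-uniform hypergraph with vertices in `ℕ`. -/
structure HGraph (r : ℕ) where
  verts : Finset ℕ
  edges : Finset (Finset ℕ)
  edge_sub : ∀ e ∈ edges, e ⊆ verts
  edge_card : ∀ e ∈ edges, e.card = r

/-- The complete `r`-graph `K_t^{(r)}` on vertex set `{0, …, t-1}`. -/
def completeHG (r t : ℕ) : HGraph r where
  verts := Finset.range t
  edges := (Finset.range t).powersetCard r
  edge_sub := fun _ he => (Finset.mem_powersetCard.mp he).1
  edge_card := fun _ he => (Finset.mem_powersetCard.mp he).2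

/-- There is a copy of `F` in `G` all of whose edges satisfy `Q`. -/
def HasCopyWith {r : ℕ} (F G : HGraph r) (Q : Finset ℕ → Prop) : Prop :=
  ∃ φ : ℕ → ℕ, Set.InjOn φ ↑F.verts ∧ (∀ v ∈ F.verts, φ v ∈ G.verts) ∧
    ∀ e ∈ F.edges, e.image φ ∈ G.edges ∧ Q (e.image φ)

/-- There is a copy of `F` in `G`. -/
def HasCopy {r : ℕ} (F G : HGraph r) : Prop := HasCopyWith F G fun _ => True

/-- `G → (F 0, …, F (l-1))`: every `l`-coloring of the edges of `G` yields a copy of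
`F i` that is monochromatic in color `i`, for some `i`. -/
def ArrowsList {r : ℕ} (G : HGraph r) (l : ℕ) (F : Fin l → HGraph r) : Prop :=
  ∀ c : Finset ℕ → Fin l, ∃ i : Fin l, HasCopyWith (F i) G fun e => c e = i

/-- `G → (F₁, F₂)`: every red-blue (`true`/`false`) coloring of the edges of `G` yields
a red copy of `F₁` or a blue copy of `F₂`. -/
def Arrows2 {r : ℕ} (G F1 F2 : HGraph r) : Prop :=
  ∀ c : Finset ℕ → Bool,
    HasCopyWith F1 G (fun e => c e = true) ∨ HasCopyWith F2 G (fun e => c e = false)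

/-- The Ramsey number `R(F 0, …, F (l-1))`. -/
noncomputable def ramseyList (r l : ℕ) (F : Fin l → HGraph r) : ℕ :=
  sInf {n | ∃ G : HGraph r, G.verts.card = n ∧ ArrowsList G l F}

/-- The two-color Ramsey number `R(F₁, F₂)`. -/
noncomputable def ramsey2 (r : ℕ) (F1 F2 : HGraph r) : ℕ :=
  sInf {n | ∃ G : HGraph r, G.verts.card = n ∧ Arrows2 G F1 F2}

/-- `J` is a subgraph of `F`. -/
def HGSub {r : ℕ} (J F : HGraph r) : Prop := J.verts ⊆ F.verts ∧ J.edges ⊆ F.edges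

/-- The maximum `r`-density `m_r(F)`. -/
noncomputable def mDensity (r : ℕ) (F : HGraph r) : ℝ :=
  if F.edges.card = 0 then 0
  else if F.edges.card = 1 then 1 / r
  else sSup {x : ℝ | ∃ J : HGraph r, HGSub J F ∧ r < J.verts.card ∧
    x = ((J.edges.card : ℝ) - 1) / ((J.verts.card : ℝ) - (r : ℝ))}

/-- The primal `r`-graph `G[H,r]` of an `s`-graph `H`. -/
def primal (r : ℕ) {s : ℕ} (H : HGraph s) : HGraph r where
  verts := H.verts
  edges := H.edges.biUnion fun A => A.powersetCard r
  edge_sub := by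
    intro e he
    obtain ⟨A, hA, heA⟩ := Finset.mem_biUnion.mp he
    exact (Finset.mem_powersetCard.mp heA).1.trans (H.edge_sub A hA)
  edge_card := by
    intro e he
    obtain ⟨A, hA, heA⟩ := Finset.mem_biUnion.mp he
    exact (Finset.mem_powersetCard.mp heA).2

/-- `H` is `r`-linear: every `r`-set of vertices lies in at most one edge. -/
def RLinear (r : ℕ) {s : ℕ} (H : HGraph s) : Prop :=
  ∀ A ∈ H.edges, ∀ B ∈ H.edges, ∀ e : Finset ℕ, e.card = r → e ⊆ A → e ⊆ B → A = B

/-- `H` is `(r,t)`-conformal: every `t`-set of vertices spanning a clique in the primal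
`r`-graph is contained in an edge of `H`. -/
def HGConformal (r t : ℕ) {s : ℕ} (H : HGraph s) : Prop :=
  ∀ W : Finset ℕ, W ⊆ H.verts → W.card = t →
    (∀ B ∈ W.powersetCard r, B ∈ (primal r H).edges) → ∃ A ∈ H.edges, W ⊆ A

/-- `E` is an `r`-cover of `W`: every `r`-subset of `W` lies in a member of `E`. -/
def IsRCover (r : ℕ) (W : Finset ℕ) (E : Finset (Finset ℕ)) : Prop :=
  ∀ B ∈ W.powersetCard r, ∃ A ∈ E, B ⊆ A

/-- `E` is a minimal non-trivial `r`-cover of `W`. -/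
def MinNontrivCover (r : ℕ) (W : Finset ℕ) (E : Finset (Finset ℕ)) : Prop :=
  IsRCover r W E ∧ E.card ≠ 1 ∧ ∀ E' ⊂ E, ¬ IsRCover r W E'

/-- `S ⊑ H`: there are `e(S)` distinct edges of `H`, one containing each edge of `S`. -/
def SqSub {r s : ℕ} (S : HGraph r) (H : HGraph s) : Prop :=
  ∃ f : Finset ℕ → Finset ℕ, Set.InjOn f ↑S.edges ∧
    ∀ e ∈ S.edges, f e ∈ H.edges ∧ e ⊆ f e

/-- The number of (labeled) copies of `F` in `G` all of whose edges satisfy `Q`. -/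
noncomputable def copyCountWith {r : ℕ} (F G : HGraph r) (Q : Finset ℕ → Prop) : ℕ :=
  Set.ncard { φ : ℕ → ℕ | (∀ v, v ∉ F.verts → φ v = 0) ∧ Set.InjOn φ ↑F.verts ∧
    (∀ v ∈ F.verts, φ v ∈ G.verts) ∧ ∀ e ∈ F.edges, e.image φ ∈ G.edges ∧ Q (e.image φ) }

/-- The number of (labeled) copies of `F` in `G`. -/
noncomputable def copyCount {r : ℕ} (F G : HGraph r) : ℕ :=
  copyCountWith F G fun _ => True

open Classical in
/-- The expected number of minimal non-trivial `r`-covers of `W` among the edges of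
`H(n,s,p)`: the sum of `p^{|𝓔|}` over collections `𝓔` of `s`-subsets of `[n]` forming a
minimal non-trivial `r`-cover of `W`. -/
noncomputable def covSum (r s n : ℕ) (p : ℝ) (W : Finset ℕ) : ℝ :=
  ∑ E ∈ ((Finset.range n).powersetCard s).powerset.filter
      (fun E => MinNontrivCover r W E),
    p ^ E.card

lemma one_lt_choose {r t : ℕ} (hr : 1 ≤ r) (hrt : r < t) : 1 < t.choose r := by
  have h : (r + 1).choose r ≤ t.choose r := Nat.choose_le_choose r hrt
  rw [Nat.choose_succ_self_right] at h
  omega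

/-- The convexity bound `C(r+a,r) - 1 ≤ a C(r+a,r-1)`, with `r` replaced by `r + 1`. -/
lemma choose_add_le_one_add_mul (r a : ℕ) :
    (r + 1 + a).choose (r + 1) ≤ 1 + a * (r + 1 + a).choose r := by
  induction a with
  | zero => simp
  | succ a ih =>
    have hP : (r + 1 + (a + 1)).choose (r + 1)
        = (r + 1 + a).choose r + (r + 1 + a).choose (r + 1) := by
      rw [← add_assoc, Nat.choose_succ_succ]
    have hmono : (r + 1 + a).choose r ≤ (r + 1 + (a + 1)).choose r :=
      Nat.choose_le_choose r (by omega)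
    nlinarith

/-- The slopes `(C(w,r) - 1) / (w - r)` are nondecreasing in `w`. -/
lemma choose_sub_one_mul_le {r w t : ℕ} (hr : 1 ≤ r) (hrw : r ≤ w) (hwt : w ≤ t) :
    ((w.choose r : ℝ) - 1) * ((t : ℝ) - r) ≤ ((t.choose r : ℝ) - 1) * ((w : ℝ) - r) := by
  obtain ⟨q, rfl⟩ : ∃ q, r = q + 1 := ⟨r - 1, by omega⟩
  obtain ⟨a, rfl⟩ := Nat.exists_eq_add_of_le hrw
  induction t, hwt using Nat.le_induction with
  | base => exact le_rfl
  | succ t hwt ih =>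
    have hA : ((q + 1 + a).choose (q + 1) : ℝ) ≤ 1 + a * (q + 1 + a).choose q :=
      mod_cast choose_add_le_one_add_mul q a
    have hmono : ((q + 1 + a).choose q : ℝ) ≤ t.choose q :=
      mod_cast Nat.choose_le_choose q hwt
    have ha : (0 : ℝ) ≤ a := a.cast_nonneg
    have hmul := mul_le_mul_of_nonneg_left hmono ha
    rw [Nat.choose_succ_succ t q]
    push_cast at ih ⊢
    linarith

/-- The maximum `r`-density of `K_t^{(r)}` is attained by the complete graph itself. -/
lemma mDensity_completeHG {r t : ℕ} (hr : 1 ≤ r) (hrt : r < t) :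
    mDensity r (completeHG r t) = ((t.choose r : ℝ) - 1) / ((t : ℝ) - r) := by
  have hcard : (completeHG r t).edges.card = t.choose r := by
    simp [completeHG]
  have hverts : (completeHG r t).verts.card = t := by
    simp [completeHG]
  have hC : 1 < t.choose r := one_lt_choose hr hrt
  have hrt' : (0 : ℝ) < (t : ℝ) - r := sub_pos.mpr (mod_cast hrt)
  rw [mDensity, hcard, if_neg (by omega), if_neg (by omega)]
  refine IsGreatest.csSup_eq
    ⟨⟨completeHG r t, ⟨subset_rfl, subset_rfl⟩, by rwa [hverts], by rw [hcard, hverts]⟩, ?_⟩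
  rintro _ ⟨J, ⟨hJv, -⟩, hJr, rfl⟩
  have hvt : J.verts.card ≤ t := hverts ▸ card_le_card hJv
  have hedges : (J.edges.card : ℝ) ≤ J.verts.card.choose r := by
    rw [← card_powersetCard]
    exact mod_cast card_le_card fun e he =>
      mem_powersetCard.mpr ⟨J.edge_sub e he, J.edge_card e he⟩
  have hJr' : (0 : ℝ) < (J.verts.card : ℝ) - r := sub_pos.mpr (mod_cast hJr)
  rw [div_le_div_iff₀ hJr' hrt']
  exact (mul_le_mul_of_nonneg_right (by linarith) hrt'.le).trans
    (choose_sub_one_mul_le hr hJr.le hvt)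

/-- The weights `|S| - r + 1 / m_r(K_t^{(r)})` of the members of an `r`-cover of a `t`-set
by subsets with at least `r` elements add up to at least the weight of the `t`-set. -/
lemma IsRCover.weight_le_sum {r : ℕ} {W : Finset ℕ} {T : Finset (Finset ℕ)} (hr : 1 ≤ r)
    (hrW : r < W.card) (hT : IsRCover r W T) (hsub : ∀ S ∈ T, S ⊆ W)
    (hcard : ∀ S ∈ T, r ≤ S.card) :
    (W.card : ℝ) - r + 1 / mDensity r (completeHG r W.card)
      ≤ ∑ S ∈ T, ((S.card : ℝ) - r + 1 / mDensity r (completeHG r W.card)) := by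
  have hC : (0 : ℝ) < (W.card.choose r : ℝ) - 1 :=
    sub_pos.mpr (mod_cast one_lt_choose hr hrW)
  have hrW' : (0 : ℝ) < (W.card : ℝ) - r := sub_pos.mpr (mod_cast hrW)
  rw [mDensity_completeHG hr hrW, one_div_div]
  set c : ℝ := ((W.card : ℝ) - r) / ((W.card.choose r : ℝ) - 1) with hc
  have hc0 : 0 ≤ c := (div_pos hrW' hC).le
  have htop : (W.card : ℝ) - r + c = W.card.choose r * c := by
    rw [hc]; field_simp; ring
  have hsum : (W.card.choose r : ℝ) ≤ ∑ S ∈ T, (S.card.choose r : ℝ) := by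
    have hsubset : W.powersetCard r ⊆ T.biUnion fun S => S.powersetCard r := by
      intro B hB
      obtain ⟨S, hS, hBS⟩ := hT B hB
      exact mem_biUnion.mpr ⟨S, hS, mem_powersetCard.mpr ⟨hBS, (mem_powersetCard.mp hB).2⟩⟩
    have h := (card_le_card hsubset).trans card_biUnion_le
    simp only [card_powersetCard] at h
    exact mod_cast h
  rw [htop]
  refine (mul_le_mul_of_nonneg_right hsum hc0).trans ?_
  rw [sum_mul]
  refine sum_le_sum fun S hS => ?_
  have hle : ((S.card.choose r : ℝ) - 1) * c ≤ (S.card : ℝ) - r := by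
    rw [hc, mul_div_assoc', div_le_iff₀ hC, mul_comm ((S.card : ℝ) - r)]
    exact choose_sub_one_mul_le hr (hcard S hS) (card_le_card (hsub S hS))
  linarith

/-- In a minimal cover, every member contains an `r`-subset of `W` that no other member
contains. -/
lemma MinNontrivCover.exists_private {r : ℕ} {W : Finset ℕ} {E : Finset (Finset ℕ)}
    (hE : MinNontrivCover r W E) {A : Finset ℕ} (hA : A ∈ E) :
    ∃ B ∈ W.powersetCard r, B ⊆ A ∧ ∀ A' ∈ E, B ⊆ A' → A' = A := by
  have hnot := hE.2.2 _ (erase_ssubset hA)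
  simp only [IsRCover, not_forall, not_exists, not_and, mem_erase] at hnot
  obtain ⟨B, hB, hBE⟩ := hnot
  have huniq : ∀ A' ∈ E, B ⊆ A' → A' = A := fun A' hA' hBA' =>
    by_contra fun hne => hBE A' ⟨hne, hA'⟩ hBA'
  obtain ⟨A', hA', hBA'⟩ := hE.1 B hB
  exact ⟨B, hB, huniq A' hA' hBA' ▸ hBA', huniq⟩

lemma MinNontrivCover.injOn_inter {r : ℕ} {W : Finset ℕ} {E : Finset (Finset ℕ)}
    (hE : MinNontrivCover r W E) : Set.InjOn (fun A => A ∩ W) (E : Set (Finset ℕ)) := by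
  intro A hA A' hA' heq
  obtain ⟨B, hB, hBA, huniq⟩ := hE.exists_private hA
  have hBW := subset_inter hBA (mem_powersetCard.mp hB).1
  rw [show A ∩ W = A' ∩ W from heq] at hBW
  exact (huniq A' hA' (hBW.trans inter_subset_left)).symm

lemma MinNontrivCover.le_card_inter {r : ℕ} {W : Finset ℕ} {E : Finset (Finset ℕ)}
    (hE : MinNontrivCover r W E) {A : Finset ℕ} (hA : A ∈ E) : r ≤ (A ∩ W).card := by
  obtain ⟨B, hB, hBA, -⟩ := hE.exists_private hA
  obtain ⟨hBW, rfl⟩ := mem_powersetCard.mp hB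
  exact card_le_card (subset_inter hBA hBW)

lemma MinNontrivCover.two_le_card {r : ℕ} {W : Finset ℕ} {E : Finset (Finset ℕ)}
    (hE : MinNontrivCover r W E) (hrW : r ≤ W.card) : 2 ≤ E.card := by
  obtain ⟨B, hB⟩ := powersetCard_nonempty.mpr hrW
  obtain ⟨A, hA, -⟩ := hE.1 B hB
  have := card_pos.mpr ⟨A, hA⟩
  have := hE.2.1
  omega

lemma IsRCover.image_inter {r : ℕ} {W : Finset ℕ} {E : Finset (Finset ℕ)}
    (hE : IsRCover r W E) : IsRCover r W (E.image (fun A => A ∩ W)) := by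
  intro B hB
  obtain ⟨A, hA, hBA⟩ := hE B hB
  exact ⟨A ∩ W, mem_image_of_mem _ hA, subset_inter hBA (mem_powersetCard.mp hB).1⟩

/-- At most `n ^ (s - |S|)` of the `s`-subsets of `[n]` have trace `S` on `W`. -/
lemma card_filter_inter_eq_le (s n : ℕ) (W S : Finset ℕ) :
    (((range n).powersetCard s).filter (fun A => A ∩ W = S)).card ≤ n ^ (s - S.card) := by
  have h : (((range n).powersetCard s).filter (fun A => A ∩ W = S)).card
      ≤ ((range n).powersetCard (s - S.card)).card := by
    refine card_le_card_of_injOn (fun A => A \ S) ?_ ?_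
    · intro A hA
      obtain ⟨hAs, rfl⟩ := mem_filter.mp hA
      obtain ⟨hAn, rfl⟩ := mem_powersetCard.mp hAs
      exact mem_powersetCard.mpr
        ⟨sdiff_subset.trans hAn, card_sdiff_of_subset inter_subset_left⟩
    · intro A hA A' hA' heq
      have hS : ∀ X ∈ ((range n).powersetCard s).filter (fun A => A ∩ W = S), S ⊆ X := by
        intro X hX
        rw [← (mem_filter.mp hX).2]
        exact inter_subset_left
      rw [← sdiff_union_of_subset (hS A hA), ← sdiff_union_of_subset (hS A' hA')]
      exact congrArg (· ∪ S) heq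
  rw [card_powersetCard, card_range] at h
  exact h.trans (Nat.choose_le_pow n _)

/-- The number of collections of `s`-subsets of `[n]` whose traces on `W` are distinct and
form the family `T` is at most `∏ S ∈ T, n ^ (s - |S|)`. -/
lemma card_le_prod_of_image_inter_eq (s n : ℕ) (W : Finset ℕ) (T : Finset (Finset ℕ))
    (F : Finset (Finset (Finset ℕ)))
    (hF : ∀ E ∈ F, E ⊆ (range n).powersetCard s ∧
      Set.InjOn (fun A => A ∩ W) (E : Set (Finset ℕ)) ∧ E.image (fun A => A ∩ W) = T) :
    F.card ≤ ∏ S ∈ T, n ^ (s - S.card) := by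
  let fiber : Finset ℕ → Finset (Finset ℕ) := fun S =>
    ((range n).powersetCard s).filter (fun A => A ∩ W = S)
  have hsub : F ⊆ (T.pi fiber).image
      (fun g => T.attach.image fun S => g S.1 S.2) := by
    intro E hE
    obtain ⟨hEs, hinj, hT⟩ := hF E hE
    have hex : ∀ S ∈ T, ∃ A ∈ E, A ∩ W = S := fun S hS => mem_image.mp (hT ▸ hS)
    choose g hgE hgW using hex
    refine mem_image.mpr ⟨g, mem_pi.mpr fun S hS =>
      mem_filter.mpr ⟨hEs (hgE S hS), hgW S hS⟩, ?_⟩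
    ext A
    simp only [mem_image, mem_attach, true_and, Subtype.exists]
    constructor
    · rintro ⟨S, hS, rfl⟩
      exact hgE S hS
    · intro hA
      have hAT : A ∩ W ∈ T := hT ▸ mem_image_of_mem _ hA
      exact ⟨A ∩ W, hAT, hinj (hgE _ hAT) hA (hgW _ hAT)⟩
  calc F.card ≤ (T.pi fiber).card := (card_le_card hsub).trans card_image_le
    _ = ∏ S ∈ T, (fiber S).card := card_pi _ _
    _ ≤ ∏ S ∈ T, n ^ (s - S.card) :=
      prod_le_prod' fun S _ => card_filter_inter_eq_le s n W S

/-- The contribution of a family `T` of traces, in terms of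
`x = p n ^ (s - r + 1 / m_r(K_t^{(r)}))`. -/
lemma IsRCover.pow_mul_prod_le {r s n : ℕ} {p : ℝ} {W : Finset ℕ} {T : Finset (Finset ℕ)}
    (hr : 1 ≤ r) (hrW : r < W.card) (hWs : W.card ≤ s) (hn : 1 ≤ n) (hp : 0 < p)
    (hx : p * (n : ℝ) ^ ((s : ℝ) - r + 1 / mDensity r (completeHG r W.card)) ≤ 1)
    (hT : IsRCover r W T) (hsub : ∀ S ∈ T, S ⊆ W) (hcard : ∀ S ∈ T, r ≤ S.card)
    (hT2 : 2 ≤ T.card) :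
    p ^ T.card * ∏ S ∈ T, (n : ℝ) ^ (s - S.card)
      ≤ p * (n : ℝ) ^ ((s : ℝ) - r + 1 / mDensity r (completeHG r W.card))
        * (p * (n : ℝ) ^ (s - W.card)) := by
  have hweight := hT.weight_le_sum hr hrW hsub hcard
  set c : ℝ := 1 / mDensity r (completeHG r W.card)
  set x : ℝ := p * (n : ℝ) ^ ((s : ℝ) - r + c) with hxdef
  have hn0 : (0 : ℝ) < n := mod_cast hn
  have hx0 : 0 < x := mul_pos hp (Real.rpow_pos_of_pos hn0 _)
  have hfactor : ∀ w ≤ s, p * (n : ℝ) ^ (s - w) = x * (n : ℝ) ^ (-((w : ℝ) - r + c)) := by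
    intro w hw
    rw [hxdef, mul_assoc, ← Real.rpow_add hn0, ← Real.rpow_natCast, Nat.cast_sub hw]
    congr 2
    ring
  have hTs : ∀ S ∈ T, S.card ≤ s := fun S hS => (card_le_card (hsub S hS)).trans hWs
  calc p ^ T.card * ∏ S ∈ T, (n : ℝ) ^ (s - S.card)
      = ∏ S ∈ T, p * (n : ℝ) ^ (s - S.card) := by rw [prod_mul_distrib, prod_const]
    _ = ∏ S ∈ T, x * (n : ℝ) ^ (-((S.card : ℝ) - r + c)) :=
      prod_congr rfl fun S hS => hfactor _ (hTs S hS)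
    _ = x ^ T.card * (n : ℝ) ^ (-∑ S ∈ T, ((S.card : ℝ) - r + c)) := by
      rw [prod_mul_distrib, prod_const, ← sum_neg_distrib, Real.rpow_sum_of_pos hn0]
    _ ≤ x ^ 2 * (n : ℝ) ^ (-((W.card : ℝ) - r + c)) := by
      gcongr ?_ * ?_
      · exact pow_le_pow_of_le_one hx0.le hx hT2
      · exact Real.rpow_le_rpow_of_exponent_le (mod_cast hn) (neg_le_neg hweight)
    _ = x * (p * (n : ℝ) ^ (s - W.card)) := by rw [hfactor _ hWs]; ring

/-- The quantitative bound behind `bad_cover`. -/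
lemma covSum_le {r s n : ℕ} {p : ℝ} {W : Finset ℕ}
    (hr : 1 ≤ r) (hrW : r < W.card) (hWs : W.card ≤ s) (hn : 1 ≤ n) (hp : 0 < p)
    (hx : p * (n : ℝ) ^ ((s : ℝ) - r + 1 / mDensity r (completeHG r W.card)) ≤ 1) :
    covSum r s n p W ≤ 2 ^ 2 ^ W.card *
      (p * (n : ℝ) ^ ((s : ℝ) - r + 1 / mDensity r (completeHG r W.card))
        * (p * (n : ℝ) ^ (s - W.card))) := by
  classical
  have hn0 : (0 : ℝ) < n := mod_cast hn
  set C : Finset (Finset (Finset ℕ)) :=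
    ((range n).powersetCard s).powerset.filter (fun E => MinNontrivCover r W E) with hC
  have hmem : ∀ E ∈ C, E ⊆ (range n).powersetCard s ∧ MinNontrivCover r W E := fun E hE =>
    ⟨mem_powerset.mp (mem_filter.mp hE).1, (mem_filter.mp hE).2⟩
  have hmaps : ∀ E ∈ C, E.image (fun A => A ∩ W) ∈ W.powerset.powerset := by
    intro E _
    simp only [mem_powerset, image_subset_iff]
    exact fun A _ => inter_subset_right
  have hcov : covSum r s n p W = ∑ E ∈ C, p ^ E.card := by
    unfold covSum
    exact sum_congr (by rw [hC]) fun _ _ => rfl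
  rw [hcov, ← sum_fiberwise_of_maps_to hmaps]
  have hcardT : (W.powerset.powerset.card : ℝ) = 2 ^ 2 ^ W.card := by
    simp [card_powerset]
  rw [← hcardT, ← nsmul_eq_mul]
  refine sum_le_card_nsmul _ _ _ fun T _ => ?_
  set F := C.filter (fun E => E.image (fun A => A ∩ W) = T) with hF
  have hFmem : ∀ E ∈ F, E ∈ C ∧ E.image (fun A => A ∩ W) = T := fun E hE => mem_filter.mp hE
  rcases F.eq_empty_or_nonempty with hempty | ⟨E, hE⟩
  · rw [hempty, sum_empty]
    positivity
  have hcardF : ∀ E ∈ F, E.card = T.card := fun E hE => by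
    obtain ⟨hEC, rfl⟩ := hFmem E hE
    exact (card_image_of_injOn (hmem E hEC).2.injOn_inter).symm
  have hcount : (F.card : ℝ) ≤ ∏ S ∈ T, (n : ℝ) ^ (s - S.card) := by
    have h := card_le_prod_of_image_inter_eq s n W T F fun E hE =>
      ⟨(hmem E (hFmem E hE).1).1, (hmem E (hFmem E hE).1).2.injOn_inter, (hFmem E hE).2⟩
    exact mod_cast h
  obtain ⟨hEC, hET⟩ := hFmem E hE
  have hEmin := (hmem E hEC).2
  have hTcov : IsRCover r W T := hET ▸ hEmin.1.image_inter
  have htrace : ∀ S ∈ T, ∃ A ∈ E, A ∩ W = S := fun S hS => mem_image.mp (hET ▸ hS)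
  calc ∑ E ∈ F, p ^ E.card = F.card * p ^ T.card := by
        rw [sum_congr rfl fun E hE => by rw [hcardF E hE], sum_const, nsmul_eq_mul]
    _ ≤ p ^ T.card * ∏ S ∈ T, (n : ℝ) ^ (s - S.card) := by
        rw [mul_comm]
        gcongr
    _ ≤ _ := by
        refine hTcov.pow_mul_prod_le hr hrW hWs hn hp hx ?_ ?_ ?_
        · intro S hS
          obtain ⟨A, -, rfl⟩ := htrace S hS
          exact inter_subset_right
        · intro S hS
          obtain ⟨A, hA, rfl⟩ := htrace S hS
          exact hEmin.le_card_inter hA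
        · exact hcardF E hE ▸ hEmin.two_le_card hrW.le

open Filter in
/-- Lemma: expected number of bad covers. -/
theorem bad_cover (r s t : ℕ) (hr : 2 ≤ r) (hrt : r < t) (hts : t ≤ s)
    (p : ℕ → ℝ) (h0 : ∀ n, 0 < p n) (h1 : ∀ n, p n ≤ 1)
    (hp : Tendsto
      (fun n : ℕ => p n * (n : ℝ) ^ ((s : ℝ) - (r : ℝ) + 1 / mDensity r (completeHG r t)))
      atTop (nhds 0)) :
    ∀ ε : ℝ, 0 < ε → ∀ᶠ n : ℕ in atTop,
      ∀ W ∈ (Finset.range n).powersetCard t,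
        covSum r s n (p n) W / (p n * (n : ℝ) ^ (s - t)) < ε := by
  intro ε hε
  have hδ : (0 : ℝ) < min 1 (ε / 2 ^ 2 ^ t) := by positivity
  filter_upwards [hp.eventually_lt_const hδ, eventually_ge_atTop 1] with n hxn hn W hW
  obtain ⟨-, rfl⟩ := mem_powersetCard.mp hW
  obtain ⟨hx1, hxε⟩ := lt_min_iff.mp hxn
  have hn0 : (0 : ℝ) < n := mod_cast hn
  have hden : 0 < p n * (n : ℝ) ^ (s - W.card) := mul_pos (h0 n) (pow_pos hn0 _)
  rw [div_lt_iff₀ hden]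
  refine (covSum_le (by omega) hrt hts hn (h0 n) hx1.le).trans_lt ?_
  rw [← mul_assoc]
  refine mul_lt_mul_of_pos_right ?_ hden
  rwa [lt_div_iff₀ (by positivity), mul_comm] at hxε
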